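/- arXiv:2507.02742 — 8 statements merged into one kernel-verified Lean document; each statement's English description precedes it below -/
import Mathlib

section
/- Let α, θ₁, θ₂ be real numbers. A single-[α,θ₁,θ₂]-defined function exists if and only if either (i) α = θ₁ = θ₂ = 0, or (ii) θ₁·θ₂ < 0, 0 < |4α| ≤ min(|θ₁|,|θ₂|), and sgn(α) = sgn(θ₁). Moreover, when such a function exists it is unique; in case (ii) it is Elastic_[α,(d₁,d₂)] with d₁ = θ₁/(2α) − 2 and d₂ = −θ₂/(2α) − 2, and in case (i) it is the zero function. -/
open Set

/-- The function `Elastic α d₁ d₂` on `[0,1]`. -/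
noncomputable def Elastic (α d₁ d₂ : ℝ) : ℝ → ℝ := fun x =>
  if x ≤ 1/2 then α * (1 - (2*x - 1)^2 * Real.exp (-2*d₁*x))
  else α * (1 - (2*x - 1)^2 * Real.exp (-2*d₂*(1-x)))

/-- `C : [0,1] → ℝ` is single-`[α,θ₁,θ₂]`-defined: it belongs to the `[α]`-elastic
family and its one-sided derivatives at the endpoints are `θ₁` and `θ₂`. -/
def IsSingleDefined (α θ₁ θ₂ : ℝ) (C : ℝ → ℝ) : Prop :=
  (∃ d₁ d₂ : ℝ, 0 ≤ d₁ ∧ 0 ≤ d₂ ∧ ∀ x ∈ Icc (0:ℝ) 1, C x = Elastic α d₁ d₂ x) ∧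
  derivWithin C (Icc 0 1) 0 = θ₁ ∧ derivWithin C (Icc 0 1) 1 = θ₂

theorem hasDerivWithinAt_elastic_zero (α d₁ d₂ : ℝ) :
    HasDerivWithinAt (Elastic α d₁ d₂) (α * (4 + 2 * d₁)) (Icc 0 1) 0 := by
  have h : HasDerivAt (fun x : ℝ => α * (1 - (2*x - 1)^2 * Real.exp (-2*d₁*x)))
      (α * (4 + 2 * d₁)) 0 := by
    have hl : HasDerivAt (fun x : ℝ => 2*x - 1) 2 0 := by
      simpa using ((hasDerivAt_id (0:ℝ)).const_mul 2).sub_const 1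
    have he : HasDerivAt (fun x : ℝ => -2*d₁*x) (-2*d₁) 0 := by
      simpa using (hasDerivAt_id (0:ℝ)).const_mul (-2*d₁)
    refine ((((hl.pow 2).mul he.exp).const_sub 1).const_mul α).congr_deriv ?_
    norm_num
    ring_nf
    simp
  refine (h.congr_of_eventuallyEq ?_).hasDerivWithinAt
  filter_upwards [Iio_mem_nhds (show (0:ℝ) < 1/2 by norm_num)] with x hx
  exact if_pos (le_of_lt hx)

theorem hasDerivWithinAt_elastic_one (α d₁ d₂ : ℝ) :
    HasDerivWithinAt (Elastic α d₁ d₂) (-(α * (4 + 2 * d₂))) (Icc 0 1) 1 := by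
  have h : HasDerivAt (fun x : ℝ => α * (1 - (2*x - 1)^2 * Real.exp (-2*d₂*(1-x))))
      (-(α * (4 + 2 * d₂))) 1 := by
    have hl : HasDerivAt (fun x : ℝ => 2*x - 1) 2 1 := by
      simpa using ((hasDerivAt_id (1:ℝ)).const_mul 2).sub_const 1
    have he : HasDerivAt (fun x : ℝ => -2*d₂*(1-x)) (2*d₂) 1 := by
      simpa using ((hasDerivAt_id (1:ℝ)).const_sub 1).const_mul (-2*d₂)
    refine ((((hl.pow 2).mul he.exp).const_sub 1).const_mul α).congr_deriv ?_
    norm_num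
    ring
  refine (h.congr_of_eventuallyEq ?_).hasDerivWithinAt
  filter_upwards [Ioi_mem_nhds (show (1/2:ℝ) < 1 by norm_num)] with x hx
  exact if_neg (not_le_of_gt hx)

/-- The endpoint slopes of an elastic function, in terms of its parameters. -/
theorem isSingleDefined_iff (α θ₁ θ₂ : ℝ) (C : ℝ → ℝ) :
    IsSingleDefined α θ₁ θ₂ C ↔ ∃ d₁ d₂ : ℝ, 0 ≤ d₁ ∧ 0 ≤ d₂ ∧
      (∀ x ∈ Icc (0:ℝ) 1, C x = Elastic α d₁ d₂ x) ∧
      α * (4 + 2 * d₁) = θ₁ ∧ -(α * (4 + 2 * d₂)) = θ₂ := by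
  have key : ∀ d₁ d₂ : ℝ, (∀ x ∈ Icc (0:ℝ) 1, C x = Elastic α d₁ d₂ x) →
      derivWithin C (Icc 0 1) 0 = α * (4 + 2 * d₁) ∧
      derivWithin C (Icc 0 1) 1 = -(α * (4 + 2 * d₂)) := by
    intro d₁ d₂ h
    have h₀ : (0:ℝ) ∈ Icc (0:ℝ) 1 := by simp
    have h₁ : (1:ℝ) ∈ Icc (0:ℝ) 1 := by simp
    have hu := uniqueDiffOn_Icc (zero_lt_one (α := ℝ))
    exact ⟨((hasDerivWithinAt_elastic_zero α d₁ d₂).congr h (h 0 h₀)).derivWithin (hu 0 h₀),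
      ((hasDerivWithinAt_elastic_one α d₁ d₂).congr h (h 1 h₁)).derivWithin (hu 1 h₁)⟩
  constructor
  · rintro ⟨⟨d₁, d₂, hd₁, hd₂, h⟩, ht₁, ht₂⟩
    obtain ⟨k₁, k₂⟩ := key d₁ d₂ h
    exact ⟨d₁, d₂, hd₁, hd₂, h, k₁.symm.trans ht₁, k₂.symm.trans ht₂⟩
  · rintro ⟨d₁, d₂, hd₁, hd₂, h, ht₁, ht₂⟩
    obtain ⟨k₁, k₂⟩ := key d₁ d₂ h
    exact ⟨⟨d₁, d₂, hd₁, hd₂, h⟩, k₁.trans ht₁, k₂.trans ht₂⟩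

theorem elastic_zero (d₁ d₂ x : ℝ) : Elastic 0 d₁ d₂ x = 0 := by
  simp [Elastic]

theorem IsSingleDefined.eq_elastic {α θ₁ θ₂ : ℝ} {C : ℝ → ℝ} (hα : α ≠ 0)
    (h : IsSingleDefined α θ₁ θ₂ C) :
    ∀ x ∈ Icc (0:ℝ) 1, C x = Elastic α (θ₁/(2*α) - 2) (-θ₂/(2*α) - 2) x := by
  obtain ⟨d₁, d₂, -, -, hC, rfl, rfl⟩ := (isSingleDefined_iff α θ₁ θ₂ C).1 h
  have e₁ : α * (4 + 2 * d₁) / (2 * α) - 2 = d₁ := by field_simp; ring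
  have e₂ : - -(α * (4 + 2 * d₂)) / (2 * α) - 2 = d₂ := by field_simp; ring
  rwa [e₁, e₂]

theorem IsSingleDefined.eq_zero {θ₁ θ₂ : ℝ} {C : ℝ → ℝ} (h : IsSingleDefined 0 θ₁ θ₂ C) :
    ∀ x ∈ Icc (0:ℝ) 1, C x = 0 := by
  obtain ⟨⟨d₁, d₂, -, -, hC⟩, -⟩ := h
  intro x hx
  rw [hC x hx, elastic_zero]

theorem exists_isSingleDefined_iff_of_ne_zero {α : ℝ} (hα : α ≠ 0) (θ₁ θ₂ : ℝ) :
    (∃ C : ℝ → ℝ, IsSingleDefined α θ₁ θ₂ C) ↔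
      0 ≤ θ₁/(2*α) - 2 ∧ 0 ≤ -θ₂/(2*α) - 2 := by
  constructor
  · rintro ⟨C, h⟩
    obtain ⟨d₁, d₂, hd₁, hd₂, hC, rfl, rfl⟩ := (isSingleDefined_iff α θ₁ θ₂ C).1 h
    have e₁ : α * (4 + 2 * d₁) / (2 * α) - 2 = d₁ := by field_simp; ring
    have e₂ : - -(α * (4 + 2 * d₂)) / (2 * α) - 2 = d₂ := by field_simp; ring
    rw [e₁, e₂]
    exact ⟨hd₁, hd₂⟩
  · rintro ⟨h₁, h₂⟩
    refine ⟨_, (isSingleDefined_iff α θ₁ θ₂ _).2 ⟨_, _, h₁, h₂, fun x _ => rfl, ?_, ?_⟩⟩ <;>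
    · field_simp
      ring

theorem slope_conditions_iff {α : ℝ} (hα : α ≠ 0) (θ₁ θ₂ : ℝ) :
    (0 ≤ θ₁/(2*α) - 2 ∧ 0 ≤ -θ₂/(2*α) - 2) ↔
      (θ₁ * θ₂ < 0 ∧ 0 < |4*α| ∧ |4*α| ≤ min |θ₁| |θ₂| ∧ Real.sign α = Real.sign θ₁) := by
  rw [sub_nonneg, sub_nonneg, le_min_iff]
  rcases lt_or_gt_of_ne hα with hneg | hpos
  · rw [le_div_iff_of_neg (by linarith), le_div_iff_of_neg (by linarith),
      abs_of_neg (show 4 * α < 0 by linarith), Real.sign_of_neg hneg]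
    constructor
    · rintro ⟨h₁, h₂⟩
      have t₁ : θ₁ < 0 := by linarith
      have t₂ : 0 < θ₂ := by linarith
      rw [abs_of_neg t₁, abs_of_pos t₂, Real.sign_of_neg t₁]
      exact ⟨mul_neg_of_neg_of_pos t₁ t₂, by linarith, ⟨by linarith, by linarith⟩, rfl⟩
    · rintro ⟨hm, -, ⟨h₁, h₂⟩, hs⟩
      have t₁ : θ₁ < 0 := by
        rcases lt_trichotomy θ₁ 0 with h | h | h
        · exact h
        · simp [h] at hm
        · rw [Real.sign_of_pos h] at hs
          norm_num at hs
      have t₂ : 0 < θ₂ := pos_of_mul_neg_right hm t₁.le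
      rw [abs_of_neg t₁] at h₁
      rw [abs_of_pos t₂] at h₂
      constructor <;> linarith
  · rw [le_div_iff₀ (by linarith), le_div_iff₀ (by linarith),
      abs_of_pos (show 0 < 4 * α by linarith), Real.sign_of_pos hpos]
    constructor
    · rintro ⟨h₁, h₂⟩
      have t₁ : 0 < θ₁ := by linarith
      have t₂ : θ₂ < 0 := by linarith
      rw [abs_of_pos t₁, abs_of_neg t₂, Real.sign_of_pos t₁]
      exact ⟨mul_neg_of_pos_of_neg t₁ t₂, by linarith, ⟨by linarith, by linarith⟩, rfl⟩
    · rintro ⟨hm, -, ⟨h₁, h₂⟩, hs⟩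
      have t₁ : 0 < θ₁ := by
        rcases lt_trichotomy θ₁ 0 with h | h | h
        · rw [Real.sign_of_neg h] at hs
          norm_num at hs
        · simp [h] at hm
        · exact h
      have t₂ : θ₂ < 0 := neg_of_mul_neg_right hm t₁.le
      rw [abs_of_pos t₁] at h₁
      rw [abs_of_neg t₂] at h₂
      constructor <;> linarith

theorem singleDefined_existence_uniqueness (α θ₁ θ₂ : ℝ) :
    ((∃ C : ℝ → ℝ, IsSingleDefined α θ₁ θ₂ C) ↔
      (α = 0 ∧ θ₁ = 0 ∧ θ₂ = 0) ∨
      (θ₁ * θ₂ < 0 ∧ 0 < |4*α| ∧ |4*α| ≤ min |θ₁| |θ₂| ∧ Real.sign α = Real.sign θ₁)) ∧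
    (∀ C₁ C₂ : ℝ → ℝ, IsSingleDefined α θ₁ θ₂ C₁ → IsSingleDefined α θ₁ θ₂ C₂ →
      ∀ x ∈ Icc (0:ℝ) 1, C₁ x = C₂ x) ∧
    (θ₁ * θ₂ < 0 → 0 < |4*α| → |4*α| ≤ min |θ₁| |θ₂| → Real.sign α = Real.sign θ₁ →
      ∀ C : ℝ → ℝ, IsSingleDefined α θ₁ θ₂ C →
        ∀ x ∈ Icc (0:ℝ) 1, C x = Elastic α (θ₁/(2*α) - 2) (-θ₂/(2*α) - 2) x) ∧
    ((α = 0 ∧ θ₁ = 0 ∧ θ₂ = 0) →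
      ∀ C : ℝ → ℝ, IsSingleDefined α θ₁ θ₂ C → ∀ x ∈ Icc (0:ℝ) 1, C x = 0) := by
  refine ⟨?_, ?_, ?_, ?_⟩
  · rcases eq_or_ne α 0 with rfl | hα
    · simp only [isSingleDefined_iff]
      constructor
      · rintro ⟨C, d₁, d₂, -, -, -, h₁, h₂⟩
        exact Or.inl ⟨trivial, by linarith, by linarith⟩
      · rintro (⟨-, rfl, rfl⟩ | ⟨-, h, -⟩)
        · exact ⟨_, 0, 0, le_rfl, le_rfl, fun x _ => rfl, by simp, by simp⟩
        · simp at h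
    · rw [exists_isSingleDefined_iff_of_ne_zero hα, slope_conditions_iff hα]
      simp only [hα, false_and, false_or]
  · intro C₁ C₂ h₁ h₂ x hx
    rcases eq_or_ne α 0 with rfl | hα
    · rw [h₁.eq_zero x hx, h₂.eq_zero x hx]
    · rw [h₁.eq_elastic hα x hx, h₂.eq_elastic hα x hx]
  · intro _ h _ _ C hC
    refine hC.eq_elastic ?_
    rintro rfl
    simp at h
  · rintro ⟨rfl, -, -⟩ C hC
    exact hC.eq_zero
end

section
/- Every single-[α,θ₁,θ₂]-defined function C is either convex on the whole interval [0,1] or concave on the whole interval [0,1]. -/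
open Set

/-- The squared positive part of `1 - 2x`, damped by `exp (-2dx)`, is convex on the real line:
both factors are nonnegative, convex and decreasing. -/
lemma convexOn_sq_max_mul_exp {d : ℝ} (hd : 0 ≤ d) :
    ConvexOn ℝ univ (fun x : ℝ => max (1 - 2*x) 0 ^ 2 * Real.exp (-2*d*x)) := by
  have h_lin : ∀ a b : ℝ, ConvexOn ℝ univ (fun x : ℝ => a + b * x) := fun a b =>
    ⟨convex_univ, fun x _ y _ s t _ _ hst => by
      simp only [smul_eq_mul]; apply le_of_eq; linear_combination (-a) * hst⟩
  have h_max : ConvexOn ℝ univ (fun x : ℝ => max (1 - 2*x) 0) := by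
    refine ((h_lin 1 (-2)).sup (convexOn_const 0 convex_univ)).congr fun x _ => ?_
    simp [sub_eq_add_neg]
  have h_sq : ConvexOn ℝ univ (fun x : ℝ => max (1 - 2*x) 0 ^ 2) :=
    h_max.pow (fun x _ => le_max_right _ _) 2
  have h_exp : ConvexOn ℝ univ (fun x : ℝ => Real.exp (-2*d*x)) := by
    have := convexOn_exp.comp_linearMap (LinearMap.mulLeft ℝ (-2*d))
    simpa [Function.comp_def] using this
  refine h_sq.mul h_exp (fun x _ => by positivity) (fun x _ => by positivity) ?_
  have h_anti_sq : Antitone (fun x : ℝ => max (1 - 2*x) 0 ^ 2) := fun x y hxy => by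
    dsimp only
    gcongr
  have h_anti_exp : Antitone (fun x : ℝ => Real.exp (-2*d*x)) := fun x y hxy =>
    Real.exp_le_exp.2 (mul_le_mul_of_nonpos_left hxy (by linarith))
  exact (h_anti_sq.monovary h_anti_exp).monovaryOn _

lemma elastic_eq_sub_mul (α d₁ d₂ x : ℝ) :
    Elastic α d₁ d₂ x = α - α * (max (1 - 2*x) 0 ^ 2 * Real.exp (-2*d₁*x)
      + max (1 - 2*(1 - x)) 0 ^ 2 * Real.exp (-2*d₂*(1 - x))) := by
  unfold Elastic
  split_ifs with h
  · rw [max_eq_left (by linarith : 0 ≤ 1 - 2*x),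
      max_eq_right (by linarith : 1 - 2*(1 - x) ≤ 0)]
    ring
  · rw [max_eq_right (by linarith : 1 - 2*x ≤ 0),
      max_eq_left (by linarith : 0 ≤ 1 - 2*(1 - x))]
    ring

theorem singleDefined_convex_or_concave (α θ₁ θ₂ : ℝ) (C : ℝ → ℝ)
    (hC : IsSingleDefined α θ₁ θ₂ C) :
    ConvexOn ℝ (Icc (0:ℝ) 1) C ∨ ConcaveOn ℝ (Icc (0:ℝ) 1) C := by
  obtain ⟨⟨d₁, d₂, hd₁, hd₂, hCE⟩, -, -⟩ := hC
  have h_refl : ConvexOn ℝ univ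
      (fun x : ℝ => max (1 - 2*(1 - x)) 0 ^ 2 * Real.exp (-2*d₂*(1 - x))) := by
    refine ((convexOn_sq_max_mul_exp hd₂).comp_affineMap
      (AffineMap.lineMap (1:ℝ) 0)).congr fun x _ => ?_
    have h : AffineMap.lineMap (1:ℝ) 0 x = 1 - x := by
      simp [AffineMap.lineMap_apply_ring']; ring
    simp only [Function.comp_apply, h]
  have h_sum := ((convexOn_sq_max_mul_exp hd₁).add h_refl).subset
    (subset_univ _) (convex_Icc (0:ℝ) 1)
  rcases le_total 0 α with hα | hα
  · right
    refine ((concaveOn_const α (convex_Icc (0:ℝ) 1)).sub (h_sum.smul hα)).congr fun x hx => ?_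
    rw [hCE x hx, elastic_eq_sub_mul]
    simp
  · left
    refine ((convexOn_const α (convex_Icc (0:ℝ) 1)).add
      (h_sum.smul (neg_nonneg.2 hα))).congr fun x hx => ?_
    rw [hCE x hx, elastic_eq_sub_mul]
    simp [sub_eq_add_neg]
end

section
/- Let C be a single-[α,θ₁,θ₂]-defined function. Then C is convex on [0,1] if and only if θ₁ ≤ 0, and C is concave on [0,1] if and only if θ₁ ≥ 0. Furthermore, C is strictly convex on [0,1] if and only if θ₁ < 0, and C is strictly concave on [0,1] if and only if θ₁ > 0. -/
open Set

theorem elastic_eq_mul (α d₁ d₂ x : ℝ) : Elastic α d₁ d₂ x = α * Elastic 1 d₁ d₂ x := by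
  unfold Elastic
  split_ifs <;> ring

/-- The slope at `x` of the left branch of `Elastic 1 d d₂`. -/
noncomputable def elasticSlope (d x : ℝ) : ℝ :=
  (4 * (1 - 2*x) + 2 * d * (1 - 2*x)^2) * Real.exp (-2*d*x)

theorem hasDerivAt_elastic_left (d x : ℝ) :
    HasDerivAt (fun x : ℝ => 1 * (1 - (2*x - 1)^2 * Real.exp (-2*d*x))) (elasticSlope d x) x := by
  have h₁ : HasDerivAt (fun x : ℝ => 2*x - 1) 2 x := by
    simpa using ((hasDerivAt_id x).const_mul 2).sub_const 1
  have h₂ : HasDerivAt (fun x : ℝ => -2*d*x) (-2*d) x := by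
    simpa using (hasDerivAt_id x).const_mul (-2*d)
  refine ((((h₁.pow 2).mul h₂.exp).const_sub 1).const_mul 1).congr_deriv ?_
  simp only [elasticSlope, Pi.pow_apply]
  push_cast
  ring

theorem hasDerivAt_elastic_right (d x : ℝ) :
    HasDerivAt (fun x : ℝ => 1 * (1 - (2*x - 1)^2 * Real.exp (-2*d*(1-x))))
      (-elasticSlope d (1 - x)) x := by
  have h := (hasDerivAt_elastic_left d (1 - x)).comp x ((hasDerivAt_id x).const_sub 1)
  refine (h.congr_deriv (mul_neg_one _)).congr_of_eventuallyEq (.of_forall fun y => ?_)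
  simp only [Function.comp]
  ring

theorem elasticSlope_strictAntiOn {d : ℝ} (hd : 0 ≤ d) :
    StrictAntiOn (elasticSlope d) (Iic (1/2)) := by
  intro x hx y hy hxy
  rw [mem_Iic] at hx hy
  have hy' : 0 ≤ 1 - 2*y := by linarith
  refine mul_lt_mul ?_ (Real.exp_le_exp.2 ?_) (Real.exp_pos _) ?_
  · have : (1 - 2*y)^2 ≤ (1 - 2*x)^2 := pow_le_pow_left₀ hy' (by linarith) 2
    nlinarith [mul_le_mul_of_nonneg_left this hd]
  · nlinarith
  · have : 0 ≤ 1 - 2*x := by linarith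
    positivity

theorem elasticSlope_half (d : ℝ) : elasticSlope d (1/2) = 0 := by
  norm_num [elasticSlope]

theorem hasDerivAt_elastic (d₁ d₂ x : ℝ) :
    HasDerivAt (Elastic 1 d₁ d₂)
      (if x ≤ 1/2 then elasticSlope d₁ x else -elasticSlope d₂ (1 - x)) x := by
  rcases lt_trichotomy x (1/2) with h | rfl | h
  · rw [if_pos h.le]
    refine (hasDerivAt_elastic_left d₁ x).congr_of_eventuallyEq ?_
    filter_upwards [Iio_mem_nhds h] with y hy
    exact if_pos (le_of_lt hy)
  · rw [if_pos le_rfl, elasticSlope_half, ← hasDerivWithinAt_univ, ← Iic_union_Ici (a := (1/2 : ℝ))]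
    refine HasDerivWithinAt.union ?_ ?_
    · have h := (hasDerivAt_elastic_left d₁ (1/2)).hasDerivWithinAt (s := Iic (1/2))
      rw [elasticSlope_half] at h
      exact h.congr (fun y hy => if_pos hy) (if_pos le_rfl)
    · have h := (hasDerivAt_elastic_right d₂ (1/2)).hasDerivWithinAt (s := Ici (1/2))
      rw [show (1 : ℝ) - 1/2 = 1/2 by norm_num, elasticSlope_half, neg_zero] at h
      have half : Elastic 1 d₁ d₂ (1/2) =
          1 * (1 - (2*(1/2) - 1)^2 * Real.exp (-2*d₂*(1-1/2))) := by
        norm_num [Elastic]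
      refine h.congr (fun y hy => ?_) half
      rcases eq_or_lt_of_le (mem_Ici.1 hy) with rfl | hy
      · exact half
      · exact if_neg hy.not_ge
  · rw [if_neg h.not_ge]
    refine (hasDerivAt_elastic_right d₂ x).congr_of_eventuallyEq ?_
    filter_upwards [Ioi_mem_nhds h] with y hy
    exact if_neg (not_le.2 hy)

theorem strictConcaveOn_elastic {d₁ d₂ : ℝ} (h₁ : 0 ≤ d₁) (h₂ : 0 ≤ d₂) :
    StrictConcaveOn ℝ (Icc (0:ℝ) 1) (Elastic 1 d₁ d₂) := by
  refine StrictAntiOn.strictConcaveOn_of_deriv (convex_Icc 0 1)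
    (fun x _ => (hasDerivAt_elastic d₁ d₂ x).continuousAt.continuousWithinAt) ?_
  intro x _ y _ hxy
  have anti₁ := elasticSlope_strictAntiOn h₁
  have anti₂ := elasticSlope_strictAntiOn h₂
  rw [(hasDerivAt_elastic d₁ d₂ x).deriv, (hasDerivAt_elastic d₁ d₂ y).deriv]
  by_cases hy : y ≤ 1/2
  · rw [if_pos hy, if_pos (hxy.le.trans hy)]
    exact anti₁ (hxy.le.trans hy) hy hxy
  rw [if_neg hy]
  rw [not_le] at hy
  have hy' : 1 - y ∈ Iic (1/2 : ℝ) := by rw [mem_Iic]; linarith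
  by_cases hx : x ≤ 1/2
  · rw [if_pos hx]
    have hx0 := anti₁.antitoneOn hx self_mem_Iic hx
    have hy0 := anti₂ hy' self_mem_Iic (by linarith : 1 - y < 1/2)
    rw [elasticSlope_half] at hx0 hy0
    linarith
  · rw [if_neg hx]
    rw [not_le] at hx
    have hx' : 1 - x ∈ Iic (1/2 : ℝ) := by rw [mem_Iic]; linarith
    exact neg_lt_neg (anti₂ hy' hx' (by linarith))

theorem strictConcaveOn_const_mul {s : Set ℝ} {f : ℝ → ℝ} {c : ℝ} (hc : 0 < c)
    (hf : StrictConcaveOn ℝ s f) : StrictConcaveOn ℝ s (fun x => c * f x) := by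
  refine ⟨hf.1, fun x hx y hy hxy a b ha hb hab => ?_⟩
  have := mul_lt_mul_of_pos_left (hf.2 hx hy hxy ha hb hab) hc
  simp only [smul_eq_mul] at this ⊢
  linarith

theorem derivWithin_zero_of_isSingleDefined {α d₁ d₂ : ℝ} {C : ℝ → ℝ}
    (hC : ∀ x ∈ Icc (0:ℝ) 1, C x = Elastic α d₁ d₂ x) :
    derivWithin C (Icc 0 1) 0 = α * (4 + 2 * d₁) := by
  have h := ((hasDerivAt_elastic d₁ d₂ 0).const_mul α).hasDerivWithinAt (s := Icc (0:ℝ) 1)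
  have h0 : (0:ℝ) ∈ Icc (0:ℝ) 1 := by simp
  have h' := (h.congr (f₁ := C) (fun y hy => (hC y hy).trans (elastic_eq_mul ..))
    ((hC 0 h0).trans (elastic_eq_mul ..))).derivWithin (uniqueDiffOn_Icc zero_lt_one 0 h0)
  rw [h']
  norm_num [elasticSlope]

theorem singleDefined_convexity_iff (α θ₁ θ₂ : ℝ) (C : ℝ → ℝ)
    (hC : IsSingleDefined α θ₁ θ₂ C) :
    (ConvexOn ℝ (Icc (0:ℝ) 1) C ↔ θ₁ ≤ 0) ∧
    (ConcaveOn ℝ (Icc (0:ℝ) 1) C ↔ 0 ≤ θ₁) ∧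
    (StrictConvexOn ℝ (Icc (0:ℝ) 1) C ↔ θ₁ < 0) ∧
    (StrictConcaveOn ℝ (Icc (0:ℝ) 1) C ↔ 0 < θ₁) := by
  obtain ⟨⟨d₁, d₂, h₁, h₂, hE⟩, rfl, -⟩ := hC
  rw [derivWithin_zero_of_isSingleDefined hE]
  have hpos : 0 < 4 + 2 * d₁ := by linarith
  have concave := strictConcaveOn_elastic h₁ h₂
  have eqOn : EqOn (fun x => α * Elastic 1 d₁ d₂ x) C (Icc 0 1) :=
    fun x hx => ((hE x hx).trans (elastic_eq_mul ..)).symm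
  have strictConcave (hα : 0 < α) : StrictConcaveOn ℝ (Icc (0:ℝ) 1) C :=
    (strictConcaveOn_const_mul hα concave).congr eqOn
  have strictConvex (hα : α < 0) : StrictConvexOn ℝ (Icc (0:ℝ) 1) C := by
    refine (strictConcaveOn_const_mul (neg_pos.2 hα) concave).neg.congr fun x hx => ?_
    simpa using eqOn hx
  have zero (hα : α = 0) : EqOn (fun _ => (0:ℝ)) C (Icc 0 1) := fun x hx => by
    simpa [hα] using eqOn hx
  have m0 : (0:ℝ) ∈ Icc (0:ℝ) 1 := by simp
  have m1 : (1:ℝ) ∈ Icc (0:ℝ) 1 := by simp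
  have hC0 : C 0 = 0 := by rw [hE 0 m0]; norm_num [Elastic]
  have hC1 : C 1 = 0 := by rw [hE 1 m1]; norm_num [Elastic]
  have hCh : C 2⁻¹ = α := by rw [hE _ (by norm_num)]; norm_num [Elastic]
  have p : (0:ℝ) < 1/2 := by norm_num
  have s : (1/2:ℝ) + 1/2 = 1 := by norm_num
  have neg_iff : α * (4 + 2 * d₁) < 0 ↔ α < 0 := by constructor <;> intro h <;> nlinarith
  rw [← not_lt, mul_pos_iff_of_pos_right hpos, not_lt, mul_nonneg_iff_of_pos_right hpos, neg_iff]
  refine ⟨⟨fun h => ?_, fun h => ?_⟩, ⟨fun h => ?_, fun h => ?_⟩, ⟨fun h => ?_, strictConvex⟩,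
    ⟨fun h => ?_, strictConcave⟩⟩
  · simpa [hC0, hC1, hCh] using h.2 m0 m1 p.le p.le s
  · rcases h.lt_or_eq with h | h
    · exact (strictConvex h).convexOn
    · exact (convexOn_const 0 (convex_Icc 0 1)).congr (zero h)
  · simpa [hC0, hC1, hCh] using h.2 m0 m1 p.le p.le s
  · rcases h.lt_or_eq with h | h
    · exact (strictConcave h).concaveOn
    · exact (concaveOn_const 0 (convex_Icc 0 1)).congr (zero h.symm)
  · simpa [hC0, hC1, hCh] using h.2 m0 m1 zero_ne_one p p s
  · simpa [hC0, hC1, hCh] using h.2 m0 m1 zero_ne_one p p s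
end

section
/- Let α, θ₁, θ₂, θ₃, θ₄ be real numbers, and let C₁ be a single-[α,θ₁,θ₂]-defined function and C₂ a single-[α,θ₃,θ₄]-defined function. Then C₁(x) = C₂(x) for all x ∈ [0,1] if and only if θ₁ = θ₃ and θ₂ = θ₄. -/
open Set

theorem derivWithin_zero_of_eqOn_elastic {α d₁ d₂ : ℝ} {C : ℝ → ℝ}
    (h : EqOn C (Elastic α d₁ d₂) (Icc 0 1)) :
    derivWithin C (Icc 0 1) 0 = α * (4 + 2 * d₁) := by
  rw [derivWithin_congr h (h (by simp))]
  exact (hasDerivWithinAt_elastic_zero α d₁ d₂).derivWithin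
    (uniqueDiffOn_Icc zero_lt_one 0 (by simp))

theorem derivWithin_one_of_eqOn_elastic {α d₁ d₂ : ℝ} {C : ℝ → ℝ}
    (h : EqOn C (Elastic α d₁ d₂) (Icc 0 1)) :
    derivWithin C (Icc 0 1) 1 = -(α * (4 + 2 * d₂)) := by
  rw [derivWithin_congr h (h (by simp))]
  exact (hasDerivWithinAt_elastic_one α d₁ d₂).derivWithin
    (uniqueDiffOn_Icc zero_lt_one 1 (by simp))

theorem singleDefined_eq_iff (α θ₁ θ₂ θ₃ θ₄ : ℝ) (C₁ C₂ : ℝ → ℝ)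
    (h₁ : IsSingleDefined α θ₁ θ₂ C₁) (h₂ : IsSingleDefined α θ₃ θ₄ C₂) :
    (∀ x ∈ Icc (0:ℝ) 1, C₁ x = C₂ x) ↔ (θ₁ = θ₃ ∧ θ₂ = θ₄) := by
  obtain ⟨⟨a, b, -, -, hC₁⟩, rfl, rfl⟩ := h₁
  obtain ⟨⟨c, d, -, -, hC₂⟩, rfl, rfl⟩ := h₂
  constructor
  · intro h
    exact ⟨derivWithin_congr h (h 0 (by simp)), derivWithin_congr h (h 1 (by simp))⟩
  · rintro ⟨h0, h1⟩ x hx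
    rw [hC₁ x hx, hC₂ x hx]
    rw [derivWithin_zero_of_eqOn_elastic hC₁, derivWithin_zero_of_eqOn_elastic hC₂] at h0
    rw [derivWithin_one_of_eqOn_elastic hC₁, derivWithin_one_of_eqOn_elastic hC₂] at h1
    by_cases hα : α = 0
    · simp [Elastic, hα]
    · have hac : a = c := by linarith [mul_left_cancel₀ hα h0]
      have hbd : b = d := by linarith [mul_left_cancel₀ hα (neg_injective h1)]
      rw [hac, hbd]
end

section
/- Let f be a single-[α,θ₁,θ₂]-defined function and let β be a real number with |α| > |β|. If g is a single-[β,θ₁,θ₂]-defined function, then |f(x)| ≥ |g(x)| for all x ∈ [0,1]. -/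
open Set

theorem sq_mul_exp_mul_le_one {a x : ℝ} (ha : 0 ≤ a) (hx : 0 ≤ x) (hx' : x ≤ 1/2) :
    (2*x - 1)^2 * Real.exp (-2*a*x) * (1 + 2*x*(2 + a)) ≤ 1 := by
  have hax : 0 ≤ a * x := mul_nonneg ha hx
  have hE : Real.exp (-2*a*x) * (1 + 2*a*x) ≤ 1 := by
    have h1 : 1 + 2*a*x ≤ Real.exp (2*a*x) := by
      linarith [Real.add_one_le_exp (2*a*x)]
    calc Real.exp (-2*a*x) * (1 + 2*a*x)
        ≤ Real.exp (-2*a*x) * Real.exp (2*a*x) := by gcongr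
      _ = 1 := by rw [← Real.exp_add]; simp
  have hu : (2*x - 1)^2 ≤ 1 := by nlinarith
  have hpoly : (2*x - 1)^2 * (1 + 4*x) ≤ 1 := by
    nlinarith [mul_nonneg (sq_nonneg x) (by linarith : 0 ≤ 3 - 4*x)]
  have hkey : (2*x - 1)^2 * (1 + 2*x*(2 + a)) ≤ 1 + 2*a*x := by nlinarith
  calc (2*x - 1)^2 * Real.exp (-2*a*x) * (1 + 2*x*(2 + a))
      = Real.exp (-2*a*x) * ((2*x - 1)^2 * (1 + 2*x*(2 + a))) := by ring
    _ ≤ Real.exp (-2*a*x) * (1 + 2*a*x) := by gcongr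
    _ ≤ 1 := hE

theorem one_sub_sq_mul_exp_nonneg {a x : ℝ} (ha : 0 ≤ a) (hx : 0 ≤ x) (hx' : x ≤ 1/2) :
    0 ≤ 1 - (2*x - 1)^2 * Real.exp (-2*a*x) := by
  have h := sq_mul_exp_mul_le_one ha hx hx'
  have h2 : 0 ≤ (2*x - 1)^2 * Real.exp (-2*a*x) * (2*x*(2 + a)) := by positivity
  linarith

/-- The map `d ↦ (1 - (2x-1)² exp (-2dx)) / (2 + d)` is antitone, in cross-multiplied form. -/
theorem one_sub_sq_mul_exp_cross_le {a b x : ℝ} (ha : 0 ≤ a) (hab : a ≤ b)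
    (hx : 0 ≤ x) (hx' : x ≤ 1/2) :
    (2 + a) * (1 - (2*x - 1)^2 * Real.exp (-2*b*x)) ≤
      (2 + b) * (1 - (2*x - 1)^2 * Real.exp (-2*a*x)) := by
  have hE : Real.exp (-2*a*x) * (1 - 2*x*(b - a)) ≤ Real.exp (-2*b*x) := by
    calc Real.exp (-2*a*x) * (1 - 2*x*(b - a))
        ≤ Real.exp (-2*a*x) * Real.exp (-2*x*(b - a)) := by
          gcongr
          linarith [Real.add_one_le_exp (-2*x*(b - a))]
      _ = Real.exp (-2*b*x) := by rw [← Real.exp_add]; ring_nf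
  have h1 := mul_le_mul_of_nonneg_left hE (by positivity : 0 ≤ (2 + a) * (2*x - 1)^2)
  have h2 := mul_le_mul_of_nonneg_left (sq_mul_exp_mul_le_one ha hx hx') (sub_nonneg.2 hab)
  linarith

theorem abs_mul_one_sub_sq_mul_exp_le {α β a b x : ℝ} (ha : 0 ≤ a) (hb : 0 ≤ b)
    (h : α * (2 + a) = β * (2 + b)) (hβ : |β| < |α|) (hx : 0 ≤ x) (hx' : x ≤ 1/2) :
    |β * (1 - (2*x - 1)^2 * Real.exp (-2*b*x))| ≤
      |α * (1 - (2*x - 1)^2 * Real.exp (-2*a*x))| := by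
  have habs : |α| * (2 + a) = |β| * (2 + b) := by
    have := congrArg abs h
    rwa [abs_mul, abs_mul, abs_of_nonneg (by linarith : 0 ≤ 2 + a),
      abs_of_nonneg (by linarith : 0 ≤ 2 + b)] at this
  have hab : a ≤ b := by
    by_contra! hlt
    nlinarith [abs_nonneg β]
  rw [abs_mul, abs_mul, abs_of_nonneg (one_sub_sq_mul_exp_nonneg ha hx hx'),
    abs_of_nonneg (one_sub_sq_mul_exp_nonneg hb hx hx')]
  have hc := mul_le_mul_of_nonneg_left (one_sub_sq_mul_exp_cross_le ha hab hx hx')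
    (abs_nonneg β)
  have ha2 : 0 < 2 + a := by linarith
  refine le_of_mul_le_mul_left ?_ ha2
  calc (2 + a) * (|β| * (1 - (2*x - 1)^2 * Real.exp (-2*b*x)))
      = |β| * ((2 + a) * (1 - (2*x - 1)^2 * Real.exp (-2*b*x))) := by ring
    _ ≤ |β| * ((2 + b) * (1 - (2*x - 1)^2 * Real.exp (-2*a*x))) := hc
    _ = (|β| * (2 + b)) * (1 - (2*x - 1)^2 * Real.exp (-2*a*x)) := by ring
    _ = (2 + a) * (|α| * (1 - (2*x - 1)^2 * Real.exp (-2*a*x))) := by rw [← habs]; ring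

theorem derivWithin_zero_of_eq_elastic {C : ℝ → ℝ} {α d₁ d₂ : ℝ}
    (hC : ∀ x ∈ Icc (0:ℝ) 1, C x = Elastic α d₁ d₂ x) :
    derivWithin C (Icc 0 1) 0 = 2 * (α * (2 + d₁)) := by
  have hd : HasDerivAt (fun x : ℝ => α * (1 - (2*x - 1)^2 * Real.exp (-2*d₁*x)))
      (2 * (α * (2 + d₁))) 0 := by
    have h1 : HasDerivAt (fun x : ℝ => 2*x - 1) 2 0 := by
      simpa using ((hasDerivAt_id (0:ℝ)).const_mul 2).sub_const 1
    have h2 : HasDerivAt (fun x : ℝ => -2*d₁*x) (-2*d₁) 0 := by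
      simpa using (hasDerivAt_id (0:ℝ)).const_mul (-2*d₁)
    refine ((((h1.pow 2).mul h2.exp).const_sub 1).const_mul α).congr_deriv ?_
    simp
    ring
  refine (hd.hasDerivWithinAt.congr_of_eventuallyEq ?_ ?_).derivWithin
    (uniqueDiffOn_Icc zero_lt_one 0 (by simp))
  · filter_upwards [self_mem_nhdsWithin,
      mem_nhdsWithin_of_mem_nhds (Iic_mem_nhds (by norm_num : (0:ℝ) < 1/2))] with x hx hx2
    rw [hC x hx, Elastic, if_pos (mem_Iic.1 hx2)]
  · rw [hC 0 (by simp), Elastic, if_pos (by norm_num)]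

theorem derivWithin_one_of_eq_elastic {C : ℝ → ℝ} {α d₁ d₂ : ℝ}
    (hC : ∀ x ∈ Icc (0:ℝ) 1, C x = Elastic α d₁ d₂ x) :
    derivWithin C (Icc 0 1) 1 = -2 * (α * (2 + d₂)) := by
  have hd : HasDerivAt (fun x : ℝ => α * (1 - (2*x - 1)^2 * Real.exp (-2*d₂*(1 - x))))
      (-2 * (α * (2 + d₂))) 1 := by
    have h1 : HasDerivAt (fun x : ℝ => 2*x - 1) 2 1 := by
      simpa using ((hasDerivAt_id (1:ℝ)).const_mul 2).sub_const 1
    have h2 : HasDerivAt (fun x : ℝ => -2*d₂*(1 - x)) (2*d₂) 1 := by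
      simpa using ((hasDerivAt_id (1:ℝ)).const_sub 1).const_mul (-2*d₂)
    refine ((((h1.pow 2).mul h2.exp).const_sub 1).const_mul α).congr_deriv ?_
    simp
    ring
  refine (hd.hasDerivWithinAt.congr_of_eventuallyEq ?_ ?_).derivWithin
    (uniqueDiffOn_Icc zero_lt_one 1 (by simp))
  · filter_upwards [self_mem_nhdsWithin,
      mem_nhdsWithin_of_mem_nhds (Ioi_mem_nhds (by norm_num : (1/2:ℝ) < 1))] with x hx hx2
    rw [hC x hx, Elastic, if_neg (not_le.2 (mem_Ioi.1 hx2))]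
  · rw [hC 1 (by simp), Elastic, if_neg (by norm_num)]

theorem singleDefined_abs_mono (α β θ₁ θ₂ : ℝ) (f g : ℝ → ℝ)
    (hf : IsSingleDefined α θ₁ θ₂ f) (hβ : |β| < |α|)
    (hg : IsSingleDefined β θ₁ θ₂ g) :
    ∀ x ∈ Icc (0:ℝ) 1, |g x| ≤ |f x| := by
  obtain ⟨⟨a₁, a₂, ha₁, ha₂, hfE⟩, hf0, hf1⟩ := hf
  obtain ⟨⟨b₁, b₂, hb₁, hb₂, hgE⟩, hg0, hg1⟩ := hg
  rw [derivWithin_zero_of_eq_elastic hfE] at hf0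
  rw [derivWithin_zero_of_eq_elastic hgE] at hg0
  rw [derivWithin_one_of_eq_elastic hfE] at hf1
  rw [derivWithin_one_of_eq_elastic hgE] at hg1
  intro x hx
  rw [hfE x hx, hgE x hx]
  unfold Elastic
  split_ifs with h
  · exact abs_mul_one_sub_sq_mul_exp_le ha₁ hb₁ (by linarith) hβ hx.1 h
  · have hsq : (2*x - 1)^2 = (2*(1 - x) - 1)^2 := by ring
    rw [hsq]
    exact abs_mul_one_sub_sq_mul_exp_le ha₂ hb₂ (by linarith) hβ (by linarith [hx.2])
      (by linarith [not_le.1 h])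
end

section
/- For all real numbers c and A with c > 1 and A > 4, and for every x ∈ [0,1/2], the inequality (2x−1)²·exp(4x)·(c·exp(−Ax) − exp(−cAx)) ≤ c − 1 holds. -/
open Set

theorem key_estimate (c A : ℝ) (hc : 1 < c) (hA : 4 < A) :
    ∀ x ∈ Icc (0:ℝ) (1/2),
      (2*x - 1)^2 * Real.exp (4*x) * (c * Real.exp (-A*x) - Real.exp (-c*A*x)) ≤ c - 1 := by
  rintro x ⟨hx0, hx1⟩
  have hu : 4 * x ≤ A * x := by gcongr
  have hu0 : 0 ≤ A * x := by linarith
  have hE : 0 < Real.exp (4*x - A*x) := Real.exp_pos _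
  have h_lin : c - Real.exp (-(c-1)*(A*x)) ≤ (c - 1) * (1 + A*x) := by
    linarith [Real.add_one_le_exp (-(c-1)*(A*x))]
  have h_inv : Real.exp (4*x - A*x) * (1 + (A*x - 4*x)) ≤ 1 := by
    calc Real.exp (4*x - A*x) * (1 + (A*x - 4*x))
        ≤ Real.exp (4*x - A*x) * Real.exp (A*x - 4*x) := by
          gcongr
          linarith [Real.add_one_le_exp (A*x - 4*x)]
      _ = 1 := by rw [← Real.exp_add]; simp
  have h_decay : Real.exp (4*x - A*x) * (1 + A*x) ≤ 1 + 4*x := by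
    calc Real.exp (4*x - A*x) * (1 + A*x)
        ≤ Real.exp (4*x - A*x) * ((1 + (A*x - 4*x)) * (1 + 4*x)) := by
          gcongr
          nlinarith [mul_nonneg hx0 (sub_nonneg.2 hu)]
      _ = Real.exp (4*x - A*x) * (1 + (A*x - 4*x)) * (1 + 4*x) := by ring
      _ ≤ 1 * (1 + 4*x) := by gcongr
      _ = 1 + 4*x := one_mul _
  have h_poly : (2*x - 1)^2 * (1 + 4*x) ≤ 1 := by
    nlinarith [mul_nonneg (sq_nonneg x) (sub_nonneg.2 hx1)]
  calc (2*x - 1)^2 * Real.exp (4*x) * (c * Real.exp (-A*x) - Real.exp (-c*A*x))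
      = (2*x - 1)^2 * (Real.exp (4*x - A*x) * (c - Real.exp (-(c-1)*(A*x)))) := by
        have h₁ : Real.exp (4*x - A*x) = Real.exp (4*x) * Real.exp (-A*x) := by
          rw [← Real.exp_add]; ring_nf
        have h₂ : Real.exp (-c*A*x) = Real.exp (-A*x) * Real.exp (-(c-1)*(A*x)) := by
          rw [← Real.exp_add]; ring_nf
        rw [h₁, h₂]; ring
    _ ≤ (2*x - 1)^2 * (Real.exp (4*x - A*x) * ((c - 1) * (1 + A*x))) := by gcongr
    _ = (c - 1) * ((2*x - 1)^2 * (Real.exp (4*x - A*x) * (1 + A*x))) := by ring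
    _ ≤ (c - 1) * ((2*x - 1)^2 * (1 + 4*x)) := by
        have := sub_pos.2 hc
        gcongr
    _ ≤ (c - 1) * 1 := by
        have := sub_pos.2 hc
        gcongr
    _ = c - 1 := mul_one _
end

section
/- Let K be a finite index set equipped with a partial order ≤, and for each k ∈ K let α_k < β_k be real numbers, so that I_k = ]α_k, β_k[ is a nonempty bounded open real interval. Suppose that for all i, j ∈ K, if j ≤ i then α_j < β_i. Then there exists a family of real numbers (φ_k)_{k ∈ K} such that φ_k ∈ ]α_k, β_k[ for every k ∈ K, and φ_j ≤ φ_i whenever j ≤ i. -/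
open Set

theorem exists_monotone_selection_open (K : Type*) [Fintype K] [PartialOrder K]
    (α β : K → ℝ) (hab : ∀ k, α k < β k)
    (h : ∀ i j : K, j ≤ i → α j < β i) :
    ∃ φ : K → ℝ, (∀ k, φ k ∈ Ioo (α k) (β k)) ∧ ∀ i j : K, j ≤ i → φ j ≤ φ i := by
  classical
  -- The midpoint of the largest `α` below `k` and the smallest `β` above `k`.
  choose a ha hmax using fun k => (toFinite (Iic k)).exists_maximalFor α _ ⟨k, le_rfl⟩
  choose b hb hmin using fun k => (toFinite (Ici k)).exists_minimalFor β _ ⟨k, le_rfl⟩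
  have le_a {j k : K} (hjk : j ≤ k) : α j ≤ α (a k) :=
    (le_total (α j) (α (a k))).elim id (hmax k hjk)
  have b_le {j k : K} (hkj : k ≤ j) : β (b k) ≤ β j :=
    (le_total (β (b k)) (β j)).elim id (hmin k hkj)
  refine ⟨fun k => (α (a k) + β (b k)) / 2, fun k => ?_, fun i j hji => ?_⟩
  · have hlt := h (b k) (a k) ((ha k).trans (hb k))
    have hα := le_a (le_refl k)
    have hβ := b_le (le_refl k)
    constructor <;> linarith
  · have hα := le_a ((ha j).trans hji)
    have hβ := b_le (hji.trans (hb i))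
    linarith
end

section
/- Let K be a finite index set equipped with a partial order ≤, and for each k ∈ K let I_k ⊆ ℝ be a nonempty bounded interval (an order-connected subset of ℝ that is nonempty and bounded). Suppose that for all i, j ∈ K, if j ≤ i then there exist x ∈ I_j and y ∈ I_i with x ≤ y. Then there exists a family of real numbers (φ_k)_{k ∈ K} such that φ_k ∈ I_k for every k ∈ K, and φ_j ≤ φ_i whenever j ≤ i. -/
open Set

theorem exists_monotone_selection (K : Type*) [Fintype K] [PartialOrder K]
    (I : K → Set ℝ)
    (hne : ∀ k, (I k).Nonempty)
    (hconn : ∀ k, (I k).OrdConnected)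
    (hbddA : ∀ k, BddAbove (I k)) (hbddB : ∀ k, BddBelow (I k))
    (h : ∀ i j : K, j ≤ i → ∃ x ∈ I j, ∃ y ∈ I i, x ≤ y) :
    ∃ φ : K → ℝ, (∀ k, φ k ∈ I k) ∧ ∀ i j : K, j ≤ i → φ j ≤ φ i := by
  have lower : ∀ j, ∃ a ∈ I j, ∀ i, j ≤ i → ∃ y ∈ I i, a ≤ y := by
    intro j
    choose x hx y hy hxy using fun i : {i // j ≤ i} => h i j i.2
    have : Nonempty {i // j ≤ i} := ⟨⟨j, le_rfl⟩⟩
    obtain ⟨i₀, hi₀⟩ := Finite.exists_min x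
    exact ⟨x i₀, hx i₀, fun i hi => ⟨y ⟨i, hi⟩, hy ⟨i, hi⟩, (hi₀ ⟨i, hi⟩).trans (hxy ⟨i, hi⟩)⟩⟩
  choose a ha hay using lower
  have upper : ∀ k, ∃ j ≤ k, ∀ i ≤ k, a i ≤ a j := by
    intro k
    have : Nonempty {j // j ≤ k} := ⟨⟨k, le_rfl⟩⟩
    obtain ⟨j, hj⟩ := Finite.exists_max fun j : {j // j ≤ k} => a j
    exact ⟨j, j.2, fun i hi => hj ⟨i, hi⟩⟩
  choose m hm hmax using upper
  refine ⟨fun k => a (m k), fun k => ?_, fun i j hji => hmax i _ ((hm j).trans hji)⟩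
  obtain ⟨y, hy, hle⟩ := hay (m k) k (hm k)
  exact (hconn k).out (ha k) hy ⟨hmax k k le_rfl, hle⟩
end
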